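/- Let P = {P_1,…,P_m} be a system of coordinate projections in M_n(ℂ) and let A, B ∈ M_n(ℂ) be positive semidefinite. Then the following are equivalent: (1) there exist a unitary U ∈ U(n) and a contraction V ∈ M_n(ℂ) with U*AU = C_P(V*BV); (2) for every convex function f : [0,∞) → [0,∞) with f(0) = 0, there exist a unitary U' ∈ U(n) and a contraction V' ∈ M_n(ℂ) with U'*f(A)U' = C_P(V'*f(B)V'). -/

import Mathlib

open Matrix
open scoped ComplexOrder

/-- `V` is a contraction: its operator norm on `ℓ²` is at most 1. -/
noncomputable def IsContraction {ι : Type*} [Fintype ι] [DecidableEq ι]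
    (V : Matrix ι ι ℂ) : Prop :=
  ∀ x : EuclideanSpace ℂ ι, ‖Matrix.toEuclideanLin V x‖ ≤ ‖x‖

/-- The `i`-th coordinate projection of the system encoded by the block-index
function `g : Fin n → Fin m` (monotone and surjective `g` corresponds to a
partition of `{1,…,n}` into `m` consecutive intervals). -/
def coordProj {n m : ℕ} (g : Fin n → Fin m) (i : Fin m) :
    Matrix (Fin n) (Fin n) ℂ :=
  Matrix.diagonal fun k => if g k = i then 1 else 0

/-- The compression `C_P(X) = Σ_i P_i X P_i` induced by the system of
coordinate projections encoded by `g`. -/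
noncomputable def coordCompress {n m : ℕ} (g : Fin n → Fin m)
    (X : Matrix (Fin n) (Fin n) ℂ) : Matrix (Fin n) (Fin n) ℂ :=
  ∑ i : Fin m, coordProj g i * X * coordProj g i

/-- The nonincreasing rearrangement `x↓` of a vector `x ∈ ℝ^n`. -/
noncomputable def sortedVec {n : ℕ} (x : Fin n → ℝ) : Fin n → ℝ :=
  fun i => ((Multiset.map x Finset.univ.val).sort (· ≥ ·)).get (Fin.cast (by simp) i)

/-- Vector majorization `x ≺ y`. -/
noncomputable def Majorizes {n : ℕ} (x y : Fin n → ℝ) : Prop :=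
  (∀ k : ℕ, k ≤ n →
      ∑ i ∈ Finset.univ.filter (fun i : Fin n => (i : ℕ) < k), sortedVec x i ≤
        ∑ i ∈ Finset.univ.filter (fun i : Fin n => (i : ℕ) < k), sortedVec y i) ∧
    ∑ i, x i = ∑ i, y i

/-- `f(A)` for a hermitian matrix `A`, via the spectral theorem. -/
noncomputable def matFun {n : ℕ} {A : Matrix (Fin n) (Fin n) ℂ}
    (hA : A.IsHermitian) (f : ℝ → ℝ) : Matrix (Fin n) (Fin n) ℂ :=
  (hA.eigenvectorUnitary : Matrix (Fin n) (Fin n) ℂ) *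
    Matrix.diagonal (fun i => (f (hA.eigenvalues i) : ℂ)) *
    star (hA.eigenvectorUnitary : Matrix (Fin n) (Fin n) ℂ)

section DiagonalForms

variable {ι κ : Type*} [Fintype ι] [Fintype κ]

/-- A system of fewer equations than unknowns, with prescribed support of the unknowns,
has a nonzero solution. -/
lemma exists_ne_zero_supported_mulVec_eq_zero (M : Matrix ι κ ℂ) (p : κ → Prop) (q : ι → Prop)
    [DecidablePred p] [DecidablePred q]
    (h : Fintype.card {j // q j} < Fintype.card {j // p j}) :
    ∃ a : κ → ℂ, a ≠ 0 ∧ (∀ j, ¬ p j → a j = 0) ∧ ∀ j, q j → (M *ᵥ a) j = 0 := by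
  have hker := LinearMap.ker_ne_bot_of_finrank_lt
    (f := (M.submatrix (Subtype.val : {j // q j} → ι) (Subtype.val : {j // p j} → κ)).mulVecLin)
    (by simpa using h)
  obtain ⟨a, ha, ha0⟩ := Submodule.exists_mem_ne_zero_of_ne_bot hker
  refine ⟨fun j => if hj : p j then a ⟨j, hj⟩ else 0, ?_, fun j hj => by simp [hj], ?_⟩
  · contrapose! ha0
    ext j
    have := congrFun ha0 j
    simpa [j.2] using this
  · intro j hj
    have := congrFun (LinearMap.mem_ker.1 ha) ⟨j, hj⟩
    simp only [mulVecLin_apply, mulVec, dotProduct, submatrix_apply, Pi.zero_apply] at this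
    refine Eq.trans (Eq.symm ?_) this
    refine Fintype.sum_of_injective _ Subtype.val_injective _ _ (fun k hk => ?_) fun k => ?_
    · have hk : ¬ p k := fun h => hk ⟨⟨k, h⟩, rfl⟩
      simp [hk]
    · simp [k.2]

variable [DecidableEq κ]

/-- The quadratic form of `R D Rᴴ`, with `D` real diagonal, in the coordinates given by `R`. -/
lemma re_quadForm_diagonalized (R : Matrix ι κ ℂ) (d : κ → ℝ) (v : ι → ℂ) :
    (star v ⬝ᵥ ((R * diagonal (fun k => (d k : ℂ)) * Rᴴ) *ᵥ v)).re =
      ∑ k, ‖(Rᴴ *ᵥ v) k‖ ^ 2 * d k := by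
  have h : star v ⬝ᵥ ((R * diagonal (fun k => (d k : ℂ)) * Rᴴ) *ᵥ v) =
      star (Rᴴ *ᵥ v) ⬝ᵥ (diagonal (fun k => (d k : ℂ)) *ᵥ (Rᴴ *ᵥ v)) := by
    rw [star_mulVec, conjTranspose_conjTranspose, ← mulVec_mulVec, ← mulVec_mulVec,
      dotProduct_mulVec]
  rw [h]
  simp only [dotProduct, mulVec_diagonal, Complex.re_sum, Pi.star_apply]
  refine Finset.sum_congr rfl fun k _ => ?_
  rw [← Complex.normSq_eq_norm_sq, Complex.normSq_apply]
  simp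
  ring

variable [DecidableEq ι]

lemma sum_norm_sq_conjTranspose_mulVec {R : Matrix ι ι ℂ} (hR : R ∈ unitaryGroup ι ℂ)
    (v : ι → ℂ) : ∑ k, ‖(Rᴴ *ᵥ v) k‖ ^ 2 = ∑ k, ‖v k‖ ^ 2 := by
  have hR' : R * Rᴴ = 1 := mem_unitaryGroup_iff.1 hR
  have h1 := re_quadForm_diagonalized R (fun _ => 1) v
  have h2 := re_quadForm_diagonalized (1 : Matrix ι ι ℂ) (fun _ => 1) v
  simp only [Complex.ofReal_one, diagonal_one, mul_one, hR', conjTranspose_one, one_mulVec]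
    at h1 h2
  rw [← h1, ← h2]

/-- If the quadratic form of `T` dominates `φ` of the quadratic form of `S` on unit vectors, with
`φ` monotone, then the ordered eigenvalues of `T` dominate `φ` of those of `S`. -/
lemma eigenvalues_dominated {S T : Matrix ι ι ℂ} (hS : S.PosSemidef) (hT : T.IsHermitian)
    {φ : ℝ → ℝ} (hφ : MonotoneOn φ (Set.Ici 0))
    (hST : ∀ v : ι → ℂ, ∑ k, ‖v k‖ ^ 2 = 1 →
      φ (star v ⬝ᵥ (S *ᵥ v)).re ≤ (star v ⬝ᵥ (T *ᵥ v)).re) (i : ι) :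
    φ (hS.1.eigenvalues i) ≤ hT.eigenvalues i := by
  set e : ι ≃ Fin (Fintype.card ι) := (Fintype.equivOfCardEq (Fintype.card_fin _)).symm
  have hs : ∀ j, e j ≤ e i → hS.1.eigenvalues i ≤ hS.1.eigenvalues j := fun j hj =>
    hS.1.eigenvalues₀_antitone hj
  have ht : ∀ j, e i ≤ e j → hT.eigenvalues j ≤ hT.eigenvalues i := fun j hj =>
    hT.eigenvalues₀_antitone hj
  set Q : Matrix ι ι ℂ := ↑hS.1.eigenvectorUnitary
  set R : Matrix ι ι ℂ := ↑hT.eigenvectorUnitary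
  have hQu : Q ∈ unitaryGroup ι ℂ := hS.1.eigenvectorUnitary.2
  have hRu : R ∈ unitaryGroup ι ℂ := hT.eigenvectorUnitary.2
  have hSd : S = Q * diagonal (fun k => (hS.1.eigenvalues k : ℂ)) * Qᴴ :=
    hS.1.spectral_theorem
  have hTd : T = R * diagonal (fun k => (hT.eigenvalues k : ℂ)) * Rᴴ :=
    hT.spectral_theorem
  have hcard : Fintype.card {j // e j < e i} < Fintype.card {j // e j ≤ e i} := by
    refine Fintype.card_lt_of_injective_of_notMem
      (fun j => ⟨j.1, j.2.le⟩) (fun a b hab => by simpa [Subtype.ext_iff] using hab)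
      (b := ⟨i, le_rfl⟩) ?_
    rintro ⟨⟨j, hj⟩, hji⟩
    simp only [Subtype.mk.injEq] at hji
    subst hji
    exact lt_irrefl _ hj
  obtain ⟨a, ha0, hap, haq⟩ := exists_ne_zero_supported_mulVec_eq_zero (Rᴴ * Q)
    (fun j => e j ≤ e i) (fun j => e j < e i) hcard
  have hpos : 0 < ∑ k, ‖a k‖ ^ 2 := by
    obtain ⟨k, hk⟩ := Function.ne_iff.1 ha0
    exact Finset.sum_pos' (fun _ _ => by positivity)
      ⟨k, Finset.mem_univ _, by have := norm_pos_iff.2 hk; positivity⟩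
  set c : ℝ := (√(∑ k, ‖a k‖ ^ 2))⁻¹ with hc
  have hc2 : c ^ 2 * ∑ k, ‖a k‖ ^ 2 = 1 := by
    rw [hc, inv_pow, Real.sq_sqrt hpos.le, inv_mul_cancel₀ hpos.ne']
  set b : ι → ℂ := (c : ℂ) • a with hb
  set v : ι → ℂ := Q *ᵥ b with hv
  have hQv : Qᴴ *ᵥ v = b := by
    rw [hv, mulVec_mulVec, mem_unitaryGroup_iff'.1 hQu |> (fun h => (h : Qᴴ * Q = 1)), one_mulVec]
  have hb1 : ∑ k, ‖b k‖ ^ 2 = 1 := by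
    rw [← hc2, Finset.mul_sum]
    refine Finset.sum_congr rfl fun k _ => ?_
    simp [hb, mul_pow]
  have hv1 : ∑ k, ‖v k‖ ^ 2 = 1 := by
    rw [← sum_norm_sq_conjTranspose_mulVec hQu v, hQv, hb1]
  have hR1 : ∑ k, ‖(Rᴴ *ᵥ v) k‖ ^ 2 = 1 := by
    rw [sum_norm_sq_conjTranspose_mulVec hRu v, hv1]
  have hSv : hS.1.eigenvalues i ≤ (star v ⬝ᵥ (S *ᵥ v)).re := by
    conv_rhs => rw [hSd]
    rw [re_quadForm_diagonalized, hQv, ← one_mul (hS.1.eigenvalues i), ← hb1, Finset.sum_mul]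
    refine Finset.sum_le_sum fun k _ => ?_
    by_cases hk : e k ≤ e i
    · exact mul_le_mul_of_nonneg_left (hs k hk) (by positivity)
    · simp [hb, hap k hk]
  have hTv : (star v ⬝ᵥ (T *ᵥ v)).re ≤ hT.eigenvalues i := by
    conv_lhs => rw [hTd]
    rw [re_quadForm_diagonalized, ← one_mul (hT.eigenvalues i), ← hR1, Finset.sum_mul]
    refine Finset.sum_le_sum fun k _ => ?_
    by_cases hk : e i ≤ e k
    · exact mul_le_mul_of_nonneg_left (ht k hk) (by positivity)
    · have : (Rᴴ *ᵥ v) k = 0 := by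
        rw [hv, mulVec_mulVec, hb, mulVec_smul, Pi.smul_apply, haq k (not_le.1 hk), smul_zero]
      simp [this]
  have h0 : 0 ≤ hS.1.eigenvalues i := hS.eigenvalues_nonneg i
  exact (hφ h0 (h0.trans hSv) hSv).trans ((hST v hv1).trans hTv)

/-- If `0 ≤ s ≤ t` are spectra of two matrices then the first matrix is a compression of
the second one by a contraction, here presented as a corner of an isometry. -/
lemma exists_contraction_of_diagonal_le {Q R : Matrix ι ι ℂ} (hQ : Q ∈ unitaryGroup ι ℂ)
    (hR : R ∈ unitaryGroup ι ℂ) {s t : ι → ℝ} (hs : ∀ i, 0 ≤ s i) (hst : ∀ i, s i ≤ t i) :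
    ∃ W N : Matrix ι ι ℂ, Wᴴ * W + Nᴴ * N = 1 ∧
      Q * diagonal (fun i => (s i : ℂ)) * Qᴴ =
        Wᴴ * (R * diagonal (fun i => (t i : ℂ)) * Rᴴ) * W := by
  have hQ' : Q * Qᴴ = 1 := mem_unitaryGroup_iff.1 hQ
  have hR' : Rᴴ * R = 1 := mem_unitaryGroup_iff'.1 hR
  have hr : ∀ i, 0 ≤ s i / t i := fun i => div_nonneg (hs i) ((hs i).trans (hst i))
  have hr1 : ∀ i, 0 ≤ 1 - s i / t i := fun i =>
    sub_nonneg.2 (div_le_one_of_le₀ (hst i) ((hs i).trans (hst i)))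
  have hdiag : ∀ c : ι → ℝ, (diagonal fun i => (c i : ℂ))ᴴ = diagonal fun i => (c i : ℂ) := by
    intro c
    rw [diagonal_conjTranspose]
    congr 1
    ext i
    simp
  refine ⟨R * diagonal (fun i => ((√(s i / t i) : ℝ) : ℂ)) * Qᴴ,
    diagonal (fun i => ((√(1 - s i / t i) : ℝ) : ℂ)) * Qᴴ, ?_, ?_⟩
  · simp only [conjTranspose_mul, conjTranspose_conjTranspose, hdiag]
    calc _ = Q * (diagonal (fun i => ((√(s i / t i) : ℝ) : ℂ)) * (Rᴴ * R) *
            diagonal (fun i => ((√(s i / t i) : ℝ) : ℂ)) +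
            diagonal (fun i => ((√(1 - s i / t i) : ℝ) : ℂ)) *
            diagonal (fun i => ((√(1 - s i / t i) : ℝ) : ℂ))) * Qᴴ := by noncomm_ring
      _ = Q * 1 * Qᴴ := by
        rw [hR', mul_one, diagonal_mul_diagonal, diagonal_mul_diagonal, diagonal_add]
        congr 2
        rw [← diagonal_one]
        congr 1
        ext i
        rw [← Complex.ofReal_mul, ← Complex.ofReal_mul, Real.mul_self_sqrt (hr i),
          Real.mul_self_sqrt (hr1 i)]
        simp
      _ = 1 := by rw [mul_one, hQ']
  · simp only [conjTranspose_mul, conjTranspose_conjTranspose, hdiag]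
    symm
    calc _ = Q * (diagonal (fun i => ((√(s i / t i) : ℝ) : ℂ)) * (Rᴴ * R) *
            diagonal (fun i => (t i : ℂ)) * (Rᴴ * R) *
            diagonal (fun i => ((√(s i / t i) : ℝ) : ℂ))) * Qᴴ := by noncomm_ring
      _ = _ := by
        rw [hR', mul_one, mul_one, diagonal_mul_diagonal, diagonal_mul_diagonal]
        congr 3
        ext i
        rw [← Complex.ofReal_mul, ← Complex.ofReal_mul]
        congr 1
        rw [mul_right_comm, Real.mul_self_sqrt (hr i)]
        rcases eq_or_ne (t i) 0 with h | h
        · have := hs i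
          have := hst i
          rw [h]
          linarith
        · field_simp

/-- Two unitary diagonalizations of the same matrix yield the same functional calculus. -/
lemma diagonalization_unique {P R : Matrix ι ι ℂ} (hP : P ∈ unitaryGroup ι ℂ)
    (hR : R ∈ unitaryGroup ι ℂ) {d e : ι → ℝ}
    (h : P * diagonal (fun i => (d i : ℂ)) * Pᴴ = R * diagonal (fun i => (e i : ℂ)) * Rᴴ)
    (f : ℝ → ℝ) :
    P * diagonal (fun i => (f (d i) : ℂ)) * Pᴴ =
      R * diagonal (fun i => (f (e i) : ℂ)) * Rᴴ := by
  have hP1 : P * Pᴴ = 1 := mem_unitaryGroup_iff.1 hP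
  have hP2 : Pᴴ * P = 1 := mem_unitaryGroup_iff'.1 hP
  have hR1 : R * Rᴴ = 1 := mem_unitaryGroup_iff.1 hR
  have hR2 : Rᴴ * R = 1 := mem_unitaryGroup_iff'.1 hR
  have hM : (Rᴴ * P) * diagonal (fun i => (d i : ℂ)) =
      diagonal (fun i => (e i : ℂ)) * (Rᴴ * P) := by
    calc _ = Rᴴ * (P * diagonal (fun i => (d i : ℂ)) * Pᴴ) * P := by
          rw [mul_assoc Rᴴ (_ * _) P, mul_assoc _ Pᴴ P, hP2, mul_one, mul_assoc Rᴴ]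
      _ = (Rᴴ * R) * (diagonal (fun i => (e i : ℂ)) * (Rᴴ * P)) := by rw [h]; noncomm_ring
      _ = _ := by rw [hR2, one_mul]
  have hMf : (Rᴴ * P) * diagonal (fun i => (f (d i) : ℂ)) =
      diagonal (fun i => (f (e i) : ℂ)) * (Rᴴ * P) := by
    ext i j
    have := congrFun (congrFun hM i) j
    simp only [mul_diagonal, diagonal_mul] at this ⊢
    by_cases h0 : (Rᴴ * P) i j = 0
    · simp [h0]
    · rw [mul_comm] at this
      rw [Complex.ofReal_injective (mul_right_cancel₀ h0 this), mul_comm]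
  calc _ = (R * Rᴴ) * P * diagonal (fun i => (f (d i) : ℂ)) * Pᴴ := by rw [hR1, one_mul]
    _ = R * ((Rᴴ * P) * diagonal (fun i => (f (d i) : ℂ))) * Pᴴ := by noncomm_ring
    _ = R * diagonal (fun i => (f (e i) : ℂ)) * Rᴴ * (P * Pᴴ) := by rw [hMf]; noncomm_ring
    _ = _ := by rw [hP1, mul_one]

end DiagonalForms

section Convexity

variable {f : ℝ → ℝ}

lemma ConvexOn.monotoneOn_of_nonneg (hf : ConvexOn ℝ (Set.Ici (0 : ℝ)) f)
    (hf0 : ∀ x, 0 ≤ x → 0 ≤ f x) (h0 : f 0 = 0) : MonotoneOn f (Set.Ici 0) := by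
  intro x hx y hy hxy
  rcases eq_or_lt_of_le (Set.mem_Ici.1 hy) with hy0 | hy0
  · rw [← hy0] at hxy ⊢
    rw [le_antisymm hxy hx]
  · have hx : 0 ≤ x := hx
    have h1 : x / y ≤ 1 := (div_le_one hy0).2 hxy
    have := hf.2 hy (Set.self_mem_Ici) (div_nonneg hx hy0.le) (sub_nonneg.2 h1)
      (by ring)
    simp only [smul_eq_mul, mul_zero, add_zero, h0, div_mul_cancel₀ x hy0.ne'] at this
    exact this.trans (mul_le_of_le_one_left (hf0 y hy) h1)

/-- Jensen's inequality for subprobability weights. -/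
lemma ConvexOn.map_sum_le_of_sum_le_one {ι : Type*} [Fintype ι]
    (hf : ConvexOn ℝ (Set.Ici (0 : ℝ)) f) (h0 : f 0 = 0) {w x : ι → ℝ}
    (hw : ∀ i, 0 ≤ w i) (hw1 : ∑ i, w i ≤ 1) (hx : ∀ i, 0 ≤ x i) :
    f (∑ i, w i * x i) ≤ ∑ i, w i * f (x i) := by
  have := hf.map_sum_le (t := (Finset.univ : Finset (Option ι)))
    (w := fun o => o.elim (1 - ∑ i, w i) w) (p := fun o => o.elim 0 x)
    (by rintro (_ | i) _ <;> simp [hw, hw1]) (by simp [Fintype.sum_option])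
    (by rintro (_ | i) _ <;> simp [hx])
  simpa [Fintype.sum_option, h0] using this

end Convexity

section Contractions

lemma IsContraction.sum_norm_sq_mulVec_le {ι : Type*} [Fintype ι] [DecidableEq ι]
    {V : Matrix ι ι ℂ} (hV : IsContraction V) (x : ι → ℂ) :
    ∑ k, ‖(V *ᵥ x) k‖ ^ 2 ≤ ∑ k, ‖x k‖ ^ 2 := by
  have := pow_le_pow_left₀ (norm_nonneg _) (hV (WithLp.toLp 2 x)) 2
  simpa [EuclideanSpace.norm_sq_eq, Matrix.toLpLin_apply] using this

lemma isContraction_of_sum_norm_sq {ι : Type*} [Fintype ι] [DecidableEq ι]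
    {V : Matrix ι ι ℂ} (hV : ∀ x : ι → ℂ, ∑ k, ‖(V *ᵥ x) k‖ ^ 2 ≤ ∑ k, ‖x k‖ ^ 2) :
    IsContraction V := by
  intro x
  refine le_of_sq_le_sq ?_ (norm_nonneg _)
  simpa [EuclideanSpace.norm_sq_eq, Matrix.toLpLin_apply] using hV (WithLp.ofLp x)

lemma IsContraction.mul {ι : Type*} [Fintype ι] [DecidableEq ι] {V W : Matrix ι ι ℂ}
    (hV : IsContraction V) (hW : IsContraction W) : IsContraction (V * W) :=
  isContraction_of_sum_norm_sq fun x => by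
    rw [← mulVec_mulVec]
    exact (hV.sum_norm_sq_mulVec_le _).trans (hW.sum_norm_sq_mulVec_le x)

lemma isContraction_of_add_eq_one {ι : Type*} [Fintype ι] [DecidableEq ι] {W N : Matrix ι ι ℂ}
    (h : Wᴴ * W + Nᴴ * N = 1) : IsContraction W := by
  refine isContraction_of_sum_norm_sq fun x => ?_
  have hq : ∀ M : Matrix ι ι ℂ, (star x ⬝ᵥ ((Mᴴ * M) *ᵥ x)).re = ∑ k, ‖(M *ᵥ x) k‖ ^ 2 := by
    intro M
    have := re_quadForm_diagonalized Mᴴ (fun _ => 1) x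
    simpa using this
  have h1 := hq 1
  simp only [one_mulVec] at h1
  rw [conjTranspose_one, one_mul, ← h, add_mulVec, dotProduct_add, Complex.add_re, hq, hq] at h1
  rw [← h1]
  exact le_add_of_nonneg_right (Finset.sum_nonneg fun _ _ => by positivity)

end Contractions

section Blocks

variable {n m : ℕ} (g : Fin n → Fin m)

/-- The block-diagonal matrix with prescribed diagonal blocks on the fibres of `g`. -/
def fiberBlockDiagonal (M : ∀ i, Matrix {k // g k = i} {k // g k = i} ℂ) :
    Matrix (Fin n) (Fin n) ℂ :=
  (blockDiagonal' M).submatrix (Equiv.sigmaFiberEquiv g).symm (Equiv.sigmaFiberEquiv g).symm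

variable (M N : ∀ i, Matrix {k // g k = i} {k // g k = i} ℂ)

lemma fiberBlockDiagonal_mul :
    fiberBlockDiagonal g (fun i => M i * N i) =
      fiberBlockDiagonal g M * fiberBlockDiagonal g N := by
  rw [fiberBlockDiagonal, blockDiagonal'_mul]
  exact (submatrix_mul_equiv _ _ _ (Equiv.sigmaFiberEquiv g).symm _).symm

lemma fiberBlockDiagonal_add :
    fiberBlockDiagonal g (fun i => M i + N i) =
      fiberBlockDiagonal g M + fiberBlockDiagonal g N := by
  have := blockDiagonal'_add M N
  rw [fiberBlockDiagonal, show (fun i => M i + N i) = M + N from rfl, this]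
  rfl

lemma fiberBlockDiagonal_conjTranspose :
    fiberBlockDiagonal g (fun i => (M i)ᴴ) = (fiberBlockDiagonal g M)ᴴ := by
  rw [fiberBlockDiagonal, ← blockDiagonal'_conjTranspose, fiberBlockDiagonal,
    conjTranspose_submatrix]

lemma fiberBlockDiagonal_diagonal (d : ∀ i, {k // g k = i} → ℂ) :
    fiberBlockDiagonal g (fun i => diagonal (d i)) =
      diagonal (fun k => d (g k) ⟨k, rfl⟩) := by
  rw [fiberBlockDiagonal, blockDiagonal'_diagonal, submatrix_diagonal_equiv]
  rfl

lemma fiberBlockDiagonal_one : fiberBlockDiagonal g (fun _ => 1) = 1 := by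
  have := fiberBlockDiagonal_diagonal g (fun _ _ => 1)
  simpa using this

lemma coordCompress_apply (X : Matrix (Fin n) (Fin n) ℂ) (k l : Fin n) :
    coordCompress g X k l = if g k = g l then X k l else 0 := by
  simp only [coordCompress, coordProj, Matrix.sum_apply, mul_diagonal, diagonal_mul]
  rw [Finset.sum_eq_single (g k)]
  · simp [eq_comm]
  · intro i _ hi
    simp [hi.symm]
  · simp

lemma coordCompress_eq_fiberBlockDiagonal (X : Matrix (Fin n) (Fin n) ℂ) :
    coordCompress g X =
      fiberBlockDiagonal g (fun _ => X.submatrix Subtype.val Subtype.val) := by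
  ext k l
  rw [coordCompress_apply, fiberBlockDiagonal, submatrix_apply, blockDiagonal'_apply]
  by_cases h : g k = g l
  · rw [if_pos h, dif_pos (by exact h)]
    have hcast : ∀ (i j : Fin m) (hij : i = j) (x : {k // g k = j}),
        ((cast (congrArg (fun i => {k // g k = i}) hij.symm) x : {k // g k = i}) : Fin n) = x := by
      rintro i _ rfl x
      rfl
    simp only [submatrix_apply]
    exact congrArg (X k) (hcast _ _ h ⟨l, rfl⟩).symm
  · rw [if_neg h, dif_neg (by exact h)]

lemma coordProj_mul_fiberBlockDiagonal (i : Fin m) :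
    coordProj g i * fiberBlockDiagonal g M = fiberBlockDiagonal g M * coordProj g i := by
  have : coordProj g i =
      fiberBlockDiagonal g (fun j => diagonal fun _ => if j = i then 1 else 0) := by
    rw [fiberBlockDiagonal_diagonal, coordProj]
  rw [this, ← fiberBlockDiagonal_mul, ← fiberBlockDiagonal_mul]
  congr 1
  ext j : 1
  ext a b
  simp

lemma coordCompress_conj_fiberBlockDiagonal (X : Matrix (Fin n) (Fin n) ℂ) :
    coordCompress g ((fiberBlockDiagonal g M)ᴴ * X * fiberBlockDiagonal g M) =
      (fiberBlockDiagonal g M)ᴴ * coordCompress g X * fiberBlockDiagonal g M := by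
  simp only [coordCompress, Finset.mul_sum, Finset.sum_mul]
  refine Finset.sum_congr rfl fun i _ => ?_
  have h1 := coordProj_mul_fiberBlockDiagonal g M i
  have h2 := coordProj_mul_fiberBlockDiagonal g (fun i => (M i)ᴴ) i
  rw [fiberBlockDiagonal_conjTranspose] at h2
  simp only [← mul_assoc, h2]
  simp only [mul_assoc, h1]

lemma fiberBlockDiagonal_mem_unitaryGroup
    (hM : ∀ i, M i ∈ unitaryGroup {k // g k = i} ℂ) :
    fiberBlockDiagonal g M ∈ unitaryGroup (Fin n) ℂ := by
  rw [mem_unitaryGroup_iff, star_eq_conjTranspose, ← fiberBlockDiagonal_conjTranspose,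
    ← fiberBlockDiagonal_mul, ← fiberBlockDiagonal_one]
  congr 1
  ext i : 1
  exact mem_unitaryGroup_iff.1 (hM i)

end Blocks

section FunctionalCalculus

variable {n : ℕ}

lemma matFun_id {A : Matrix (Fin n) (Fin n) ℂ} (hA : A.IsHermitian) :
    matFun hA (fun x => x) = A :=
  hA.spectral_theorem.symm

lemma matFun_eq_of_diagonalization {A R : Matrix (Fin n) (Fin n) ℂ} (hA : A.IsHermitian)
    (hR : R ∈ unitaryGroup (Fin n) ℂ) {e : Fin n → ℝ}
    (h : A = R * diagonal (fun i => (e i : ℂ)) * Rᴴ) (f : ℝ → ℝ) :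
    matFun hA f = R * diagonal (fun i => (f (e i) : ℂ)) * Rᴴ :=
  diagonalization_unique hA.eigenvectorUnitary.2 hR
    (hA.spectral_theorem.symm.trans h) f

lemma matFun_posSemidef {B : Matrix (Fin n) (Fin n) ℂ} (hB : B.PosSemidef) {f : ℝ → ℝ}
    (hf0 : ∀ x, 0 ≤ x → 0 ≤ f x) : (matFun hB.1 f).PosSemidef := by
  have h : (diagonal fun i => (f (hB.1.eigenvalues i) : ℂ)).PosSemidef :=
    PosSemidef.diagonal fun i => by
      simpa using hf0 _ (hB.eigenvalues_nonneg i)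
  exact h.mul_mul_conjTranspose_same (hB.1.eigenvectorUnitary : Matrix (Fin n) (Fin n) ℂ)

/-- Jensen's inequality for vectors in the unit ball. -/
lemma map_re_quadForm_le {B : Matrix (Fin n) (Fin n) ℂ} (hB : B.PosSemidef) {f : ℝ → ℝ}
    (hf : ConvexOn ℝ (Set.Ici (0 : ℝ)) f) (h0 : f 0 = 0) {v : Fin n → ℂ}
    (hv : ∑ k, ‖v k‖ ^ 2 ≤ 1) :
    f (star v ⬝ᵥ (B *ᵥ v)).re ≤ (star v ⬝ᵥ (matFun hB.1 f *ᵥ v)).re := by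
  set R : Matrix (Fin n) (Fin n) ℂ := ↑hB.1.eigenvectorUnitary
  have hR : R ∈ unitaryGroup (Fin n) ℂ := hB.1.eigenvectorUnitary.2
  have h1 : (star v ⬝ᵥ (B *ᵥ v)).re = ∑ k, ‖(Rᴴ *ᵥ v) k‖ ^ 2 * hB.1.eigenvalues k := by
    rw [← re_quadForm_diagonalized]
    conv_lhs => rw [hB.1.spectral_theorem]
    rfl
  have h2 : (star v ⬝ᵥ (matFun hB.1 f *ᵥ v)).re =
      ∑ k, ‖(Rᴴ *ᵥ v) k‖ ^ 2 * f (hB.1.eigenvalues k) := by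
    rw [← re_quadForm_diagonalized]
    rfl
  rw [h1, h2]
  refine hf.map_sum_le_of_sum_le_one h0 (fun _ => by positivity) ?_ hB.eigenvalues_nonneg
  rwa [sum_norm_sq_conjTranspose_mulVec hR]

lemma quadForm_conj (C V : Matrix (Fin n) (Fin n) ℂ) (x : Fin n → ℂ) :
    star x ⬝ᵥ ((Vᴴ * C * V) *ᵥ x) = star (V *ᵥ x) ⬝ᵥ (C *ᵥ (V *ᵥ x)) := by
  rw [star_mulVec, ← mulVec_mulVec, ← mulVec_mulVec, dotProduct_mulVec]

variable {p : Fin n → Prop} [DecidablePred p]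

lemma sum_norm_sq_extend_val (v : {k // p k} → ℂ) :
    ∑ k, ‖Function.extend Subtype.val v 0 k‖ ^ 2 = ∑ k, ‖v k‖ ^ 2 := by
  symm
  refine Fintype.sum_of_injective _ Subtype.val_injective _ _ (fun k hk => ?_) fun k => ?_
  · simp [Function.extend_apply' _ _ _ hk]
  · rw [Subtype.val_injective.extend_apply]

lemma quadForm_submatrix_val (M : Matrix (Fin n) (Fin n) ℂ) (v : {k // p k} → ℂ) :
    star v ⬝ᵥ (M.submatrix Subtype.val Subtype.val *ᵥ v) =
      star (Function.extend Subtype.val v 0) ⬝ᵥ (M *ᵥ Function.extend Subtype.val v 0) := by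
  simp only [dotProduct, mulVec]
  refine Fintype.sum_of_injective _ Subtype.val_injective _ _ (fun k hk => ?_) fun k => ?_
  · simp [Function.extend_apply' _ _ _ hk]
  · rw [Pi.star_apply, Pi.star_apply, Subtype.val_injective.extend_apply]
    congr 1
    refine Fintype.sum_of_injective _ Subtype.val_injective _ _ (fun l hl => ?_) fun l => ?_
    · simp [Function.extend_apply' _ _ _ hl]
    · rw [Subtype.val_injective.extend_apply, submatrix_apply]

/-- Compressing by a contraction and restricting to coordinates: `f` of the ordered eigenvalues of
the corner of `Vᴴ B V` is dominated by those of the corner of `Vᴴ f(B) V`. -/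
lemma map_eigenvalues_corner_le {B V : Matrix (Fin n) (Fin n) ℂ} (hB : B.PosSemidef)
    (hV : IsContraction V) {f : ℝ → ℝ} (hf0 : ∀ x, 0 ≤ x → 0 ≤ f x)
    (hf : ConvexOn ℝ (Set.Ici (0 : ℝ)) f) (h0 : f 0 = 0)
    (hS : ((Vᴴ * B * V).submatrix (Subtype.val : {k // p k} → Fin n) Subtype.val).PosSemidef)
    (hT : ((Vᴴ * matFun hB.1 f * V).submatrix
      (Subtype.val : {k // p k} → Fin n) Subtype.val).IsHermitian) (i : {k // p k}) :
    f (hS.1.eigenvalues i) ≤ hT.eigenvalues i := by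
  refine eigenvalues_dominated hS hT (hf.monotoneOn_of_nonneg hf0 h0) (fun v hv => ?_) i
  rw [quadForm_submatrix_val, quadForm_submatrix_val, quadForm_conj, quadForm_conj]
  refine map_re_quadForm_le hB hf h0 ((hV.sum_norm_sq_mulVec_le _).trans ?_)
  rw [sum_norm_sq_extend_val, hv]

end FunctionalCalculus

/-- (extended submajorization is equivalent to its stability
under all convex functions `f : [0,∞) → [0,∞)` with `f(0) = 0`). -/
theorem stmt_15 {n m : ℕ} (g : Fin n → Fin m) (hg_mono : Monotone g)
    (hg_surj : Function.Surjective g)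
    (A B : Matrix (Fin n) (Fin n) ℂ) (hA : A.PosSemidef) (hB : B.PosSemidef) :
    (∃ U ∈ Matrix.unitaryGroup (Fin n) ℂ, ∃ V : Matrix (Fin n) (Fin n) ℂ,
        IsContraction V ∧ Uᴴ * A * U = coordCompress g (Vᴴ * B * V)) ↔
      (∀ f : ℝ → ℝ, (∀ x : ℝ, 0 ≤ x → 0 ≤ f x) →
        ConvexOn ℝ (Set.Ici (0 : ℝ)) f → f 0 = 0 →
        ∃ U' ∈ Matrix.unitaryGroup (Fin n) ℂ, ∃ V' : Matrix (Fin n) (Fin n) ℂ,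
          IsContraction V' ∧
          U'ᴴ * matFun hA.1 f * U' = coordCompress g (V'ᴴ * matFun hB.1 f * V')) := by
  constructor
  · rintro ⟨U, hU, V, hV, hUV⟩ f hf0 hf h0
    have hU1 : U * Uᴴ = 1 := mem_unitaryGroup_iff.1 hU
    have hU2 : Uᴴ * U = 1 := mem_unitaryGroup_iff'.1 hU
    set F := matFun hB.1 f
    have hS : ∀ i, ((Vᴴ * B * V).submatrix
        (Subtype.val : {k // g k = i} → Fin n) Subtype.val).PosSemidef := fun i =>
      (hB.conjTranspose_mul_mul_same V).submatrix _
    have hT : ∀ i, ((Vᴴ * F * V).submatrix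
        (Subtype.val : {k // g k = i} → Fin n) Subtype.val).PosSemidef := fun i =>
      ((matFun_posSemidef hB hf0).conjTranspose_mul_mul_same V).submatrix _
    choose W N hWN hW using fun i =>
      exists_contraction_of_diagonal_le (hS i).1.eigenvectorUnitary.2
        (hT i).1.eigenvectorUnitary.2
        (fun k => hf0 _ ((hS i).eigenvalues_nonneg k))
        (fun k => map_eigenvalues_corner_le hB hV hf0 hf h0 (hS i) (hT i).1 k)
    have hST : ∀ i, (hS i).1.eigenvectorUnitary.1 *
        diagonal (fun k => (f ((hS i).1.eigenvalues k) : ℂ)) *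
        (hS i).1.eigenvectorUnitary.1ᴴ =
        (W i)ᴴ * (Vᴴ * F * V).submatrix Subtype.val Subtype.val * W i := fun i => by
      rw [hW i]
      congr 2
      exact (hT i).1.spectral_theorem.symm
    set Q := fiberBlockDiagonal g (fun i => (hS i).1.eigenvectorUnitary.1)
    have hQu : Q ∈ unitaryGroup (Fin n) ℂ :=
      fiberBlockDiagonal_mem_unitaryGroup g _ fun i => (hS i).1.eigenvectorUnitary.2
    have hconj : ∀ φ : ℝ → ℝ, fiberBlockDiagonal g (fun i => (hS i).1.eigenvectorUnitary.1 *
        diagonal (fun k => (φ ((hS i).1.eigenvalues k) : ℂ)) *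
        (hS i).1.eigenvectorUnitary.1ᴴ) =
        Q * diagonal (fun k => (φ ((hS (g k)).1.eigenvalues ⟨k, rfl⟩) : ℂ)) * Qᴴ := by
      intro φ
      rw [fiberBlockDiagonal_mul, fiberBlockDiagonal_mul, fiberBlockDiagonal_conjTranspose,
        fiberBlockDiagonal_diagonal]
    have hA' : A = (U * Q) *
        diagonal (fun k => ((hS (g k)).1.eigenvalues ⟨k, rfl⟩ : ℂ)) * (U * Q)ᴴ := by
      have h1 : coordCompress g (Vᴴ * B * V) =
          Q * diagonal (fun k => ((hS (g k)).1.eigenvalues ⟨k, rfl⟩ : ℂ)) * Qᴴ := by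
        rw [coordCompress_eq_fiberBlockDiagonal, ← hconj fun x => x]
        congr 1
        ext i : 1
        exact (hS i).1.spectral_theorem
      calc A = (U * Uᴴ) * A * (U * Uᴴ) := by rw [hU1, one_mul, mul_one]
        _ = U * (Uᴴ * A * U) * Uᴴ := by noncomm_ring
        _ = _ := by rw [hUV, h1, conjTranspose_mul]; noncomm_ring
    have hfA := matFun_eq_of_diagonalization hA.1 (mul_mem hU hQu) hA' f
    have hWc : IsContraction (fiberBlockDiagonal g W) := by
      refine isContraction_of_add_eq_one (N := fiberBlockDiagonal g N) ?_
      rw [← fiberBlockDiagonal_conjTranspose, ← fiberBlockDiagonal_conjTranspose,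
        ← fiberBlockDiagonal_mul, ← fiberBlockDiagonal_mul, ← fiberBlockDiagonal_add,
        ← fiberBlockDiagonal_one]
      congr 1
      ext i : 1
      exact hWN i
    refine ⟨U, hU, V * fiberBlockDiagonal g W, hV.mul hWc, ?_⟩
    calc Uᴴ * matFun hA.1 f * U
        = (Uᴴ * U) * (Q * diagonal
            (fun k => (f ((hS (g k)).1.eigenvalues ⟨k, rfl⟩) : ℂ)) * Qᴴ) * (Uᴴ * U) := by
          rw [hfA, conjTranspose_mul]; noncomm_ring
      _ = fiberBlockDiagonal g (fun i =>
            (W i)ᴴ * (Vᴴ * F * V).submatrix Subtype.val Subtype.val * W i) := by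
          rw [hU2, one_mul, mul_one, ← hconj f]
          simp only [hST]
      _ = (fiberBlockDiagonal g W)ᴴ * coordCompress g (Vᴴ * F * V) *
            fiberBlockDiagonal g W := by
          rw [fiberBlockDiagonal_mul, fiberBlockDiagonal_mul, fiberBlockDiagonal_conjTranspose,
            coordCompress_eq_fiberBlockDiagonal]
      _ = _ := by
          rw [← coordCompress_conj_fiberBlockDiagonal, conjTranspose_mul]
          simp only [mul_assoc]
  · intro h
    simpa only [matFun_id] using
      h (fun x => x) (fun _ hx => hx) (convexOn_id (convex_Ici 0)) rfl
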